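/- arXiv:2302.08846 — 4 statements merged into one kernel-verified Lean document; each statement's English description precedes it below -/
import Mathlib

section
/- Saddle-point property of the game Hamiltonian: let P be a symmetric n×n real matrix solving the GARE for some γ > 0, and fix x ∈ ℝⁿ. Define the function 𝓗(u, w) = xᵀQx + uᵀRu − γ²wᵀw + 2xᵀP(Ax + B₁u + B₂w), and set u* = −R⁻¹B₁ᵀPx, w* = γ⁻²B₂ᵀPx. Then for every u ∈ ℝᵖ and every w ∈ ℝ^q, 𝓗(u*, w) ≤ 𝓗(u*, w*) = 0 ≤ 𝓗(u, w*); i.e., (u*, w*) is a saddle point of 𝓗 with value zero. -/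
open Matrix

section

variable {ι κ l : Type*} [Fintype ι] [Fintype κ] [Fintype l]

theorem dotProduct_mulVec_eq_transpose_mulVec_dotProduct (M : Matrix ι κ ℝ) (v : ι → ℝ)
    (w : κ → ℝ) : v ⬝ᵥ (M *ᵥ w) = (Mᵀ *ᵥ v) ⬝ᵥ w := by
  rw [dotProduct_mulVec, mulVec_transpose]

theorem dotProduct_mulVec_comm_of_isSymm {M : Matrix ι ι ℝ} (hM : M.IsSymm) (v w : ι → ℝ) :
    v ⬝ᵥ (M *ᵥ w) = w ⬝ᵥ (M *ᵥ v) := by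
  rw [dotProduct_mulVec_eq_transpose_mulVec_dotProduct, hM.eq, dotProduct_comm]

/-- The quadratic form of the generalized algebraic Riccati equation at `x`. -/
theorem quadraticForm_riccati_eq_zero [DecidableEq κ] {A Q P : Matrix ι ι ℝ} {B₁ : Matrix ι κ ℝ}
    {B₂ : Matrix ι l ℝ} {R : Matrix κ κ ℝ} {c : ℝ} (hP : P.IsSymm)
    (h : P * A + Aᵀ * P - P * (B₁ * R⁻¹ * B₁ᵀ - c • (B₂ * B₂ᵀ)) * P + Q = 0) (x : ι → ℝ) :
    2 * (x ⬝ᵥ (P *ᵥ (A *ᵥ x)))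
      - (B₁ᵀ *ᵥ (P *ᵥ x)) ⬝ᵥ (R⁻¹ *ᵥ (B₁ᵀ *ᵥ (P *ᵥ x)))
      + c * ((B₂ᵀ *ᵥ (P *ᵥ x)) ⬝ᵥ (B₂ᵀ *ᵥ (P *ᵥ x))) + x ⬝ᵥ (Q *ᵥ x) = 0 := by
  have hx := congrArg (fun M : Matrix ι ι ℝ => x ⬝ᵥ (M *ᵥ x)) h
  simp only [add_mulVec, sub_mulVec, smul_mulVec, ← mulVec_mulVec, mulVec_sub, mulVec_smul,
    dotProduct_add, dotProduct_sub, dotProduct_smul, smul_eq_mul, zero_mulVec,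
    dotProduct_zero] at hx
  have hA : x ⬝ᵥ (Aᵀ *ᵥ (P *ᵥ x)) = x ⬝ᵥ (P *ᵥ (A *ᵥ x)) := by
    rw [dotProduct_mulVec_eq_transpose_mulVec_dotProduct Aᵀ, transpose_transpose,
      dotProduct_mulVec_comm_of_isSymm hP]
  rw [hA, dotProduct_mulVec_eq_transpose_mulVec_dotProduct P x (B₁ *ᵥ _),
    dotProduct_mulVec_eq_transpose_mulVec_dotProduct P x (B₂ *ᵥ _), hP.eq,
    dotProduct_mulVec_eq_transpose_mulVec_dotProduct B₁,
    dotProduct_mulVec_eq_transpose_mulVec_dotProduct B₂] at hx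
  linarith

/-- Completing the square in the game Hamiltonian at a solution of the Riccati equation. -/
theorem gameHamiltonian_eq_sub_of_riccati [DecidableEq κ] {A Q P : Matrix ι ι ℝ}
    {B₁ : Matrix ι κ ℝ} {B₂ : Matrix ι l ℝ} {R : Matrix κ κ ℝ} {c : ℝ} (hc : c ≠ 0)
    (hR : R.IsSymm) (hdet : IsUnit R.det) (hP : P.IsSymm)
    (h : P * A + Aᵀ * P - P * (B₁ * R⁻¹ * B₁ᵀ - c⁻¹ • (B₂ * B₂ᵀ)) * P + Q = 0) (x : ι → ℝ)
    {u₀ : κ → ℝ} (hu₀ : u₀ = -((R⁻¹ * B₁ᵀ * P) *ᵥ x))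
    {w₀ : l → ℝ} (hw₀ : w₀ = c⁻¹ • ((B₂ᵀ * P) *ᵥ x)) (u : κ → ℝ) (w : l → ℝ) :
    x ⬝ᵥ (Q *ᵥ x) + u ⬝ᵥ (R *ᵥ u) - c * (w ⬝ᵥ w)
        + 2 * (x ⬝ᵥ (P *ᵥ (A *ᵥ x + B₁ *ᵥ u + B₂ *ᵥ w)))
      = (u - u₀) ⬝ᵥ (R *ᵥ (u - u₀)) - c * ((w - w₀) ⬝ᵥ (w - w₀)) := by
  have hx := quadraticForm_riccati_eq_zero hP h x
  set a := B₁ᵀ *ᵥ (P *ᵥ x) with ha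
  set b := B₂ᵀ *ᵥ (P *ᵥ x) with hb
  have hu : u₀ = -(R⁻¹ *ᵥ a) := by rw [hu₀, ha, mulVec_mulVec, mulVec_mulVec, Matrix.mul_assoc]
  have hw : w₀ = c⁻¹ • b := by rw [hw₀, hb, mulVec_mulVec]
  have hRu : R *ᵥ u₀ = -a := by
    rw [hu, mulVec_neg, mulVec_mulVec, mul_nonsing_inv R hdet, one_mulVec]
  have hsymm : u₀ ⬝ᵥ (R *ᵥ u) = u ⬝ᵥ (R *ᵥ u₀) := dotProduct_mulVec_comm_of_isSymm hR u₀ u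
  have hu₀a : u₀ ⬝ᵥ a = -(a ⬝ᵥ (R⁻¹ *ᵥ a)) := by rw [hu, neg_dotProduct, dotProduct_comm]
  have hB₁ : x ⬝ᵥ (P *ᵥ (B₁ *ᵥ u)) = u ⬝ᵥ a := by
    rw [dotProduct_mulVec_eq_transpose_mulVec_dotProduct P, hP.eq,
      dotProduct_mulVec_eq_transpose_mulVec_dotProduct B₁, dotProduct_comm]
  have hB₂ : x ⬝ᵥ (P *ᵥ (B₂ *ᵥ w)) = w ⬝ᵥ b := by
    rw [dotProduct_mulVec_eq_transpose_mulVec_dotProduct P, hP.eq,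
      dotProduct_mulVec_eq_transpose_mulVec_dotProduct B₂, dotProduct_comm]
  simp only [mulVec_add, mulVec_sub, dotProduct_add, dotProduct_sub, sub_dotProduct, hB₁, hB₂,
    hsymm, hRu, dotProduct_neg, hu₀a]
  simp only [hw, dotProduct_smul, smul_dotProduct, smul_eq_mul, dotProduct_comm b w]
  field_simp at hx ⊢
  linarith

end

theorem saddle_point_of_game_hamiltonian
    {n p q m : ℕ}
    (A : Matrix (Fin n) (Fin n) ℝ) (B₁ : Matrix (Fin n) (Fin p) ℝ)
    (B₂ : Matrix (Fin n) (Fin q) ℝ) (C : Matrix (Fin m) (Fin n) ℝ)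
    (R : Matrix (Fin p) (Fin p) ℝ) (hR : R.PosDef)
    (γ : ℝ) (hγ : 0 < γ)
    (Q : Matrix (Fin n) (Fin n) ℝ) (hQ : Q = Cᵀ * C)
    (P : Matrix (Fin n) (Fin n) ℝ) (hP : P.IsSymm)
    (hGARE : P * A + Aᵀ * P
        - P * (B₁ * R⁻¹ * B₁ᵀ - (γ ^ 2)⁻¹ • (B₂ * B₂ᵀ)) * P + Q = 0)
    (x : Fin n → ℝ)
    (H : (Fin p → ℝ) → (Fin q → ℝ) → ℝ)
    (hH : ∀ (u : Fin p → ℝ) (w : Fin q → ℝ),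
      H u w = x ⬝ᵥ (Q *ᵥ x) + u ⬝ᵥ (R *ᵥ u) - γ ^ 2 * (w ⬝ᵥ w)
        + 2 * (x ⬝ᵥ (P *ᵥ (A *ᵥ x + B₁ *ᵥ u + B₂ *ᵥ w))))
    (ustar : Fin p → ℝ) (hustar : ustar = -((R⁻¹ * B₁ᵀ * P) *ᵥ x))
    (wstar : Fin q → ℝ) (hwstar : wstar = (γ ^ 2)⁻¹ • ((B₂ᵀ * P) *ᵥ x)) :
    (∀ (u : Fin p → ℝ) (w : Fin q → ℝ),
      H ustar w ≤ H ustar wstar ∧ H ustar wstar = 0 ∧ H ustar wstar ≤ H u wstar) := by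
  intro u w
  have hγ2 : 0 < γ ^ 2 := by positivity
  have key (u w) : H u w
      = (u - ustar) ⬝ᵥ (R *ᵥ (u - ustar)) - γ ^ 2 * ((w - wstar) ⬝ᵥ (w - wstar)) :=
    (hH u w).trans <| gameHamiltonian_eq_sub_of_riccati hγ2.ne' hR.isHermitian
      hR.det_pos.ne'.isUnit hP hGARE x hustar hwstar u w
  have hzero : H ustar wstar = 0 := by simp [key]
  refine ⟨?_, hzero, ?_⟩
  · have hw : 0 ≤ (w - wstar) ⬝ᵥ (w - wstar) := dotProduct_self_star_nonneg _
    rw [hzero, key]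
    simpa using mul_nonneg hγ2.le hw
  · rw [hzero, key]
    simpa using hR.posSemidef.dotProduct_mulVec_nonneg (u - ustar)
end

section
/- Hurwitz property of the closed loop (content of the paper's Corollary 5): let γ > 0 and S := B₁R⁻¹B₁ᵀ − γ⁻²B₂B₂ᵀ. Suppose Q is positive definite, S is positive semidefinite, and P is a symmetric positive definite n×n real matrix solving the GARE. Then A_γ := A − SP is Hurwitz, i.e., every complex eigenvalue of A_γ has strictly negative real part. -/
open Matrix

/-- A real square matrix is Hurwitz if every complex eigenvalue has
strictly negative real part. -/
def IsHurwitz {n : ℕ} (M : Matrix (Fin n) (Fin n) ℝ) : Prop :=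
  ∀ μ ∈ spectrum ℂ (M.map (Complex.ofReal)), μ.re < 0

/-- A complex eigenpair of a real matrix, split into real and imaginary parts. -/
theorem exists_re_im_of_mem_spectrum {n : ℕ} {M : Matrix (Fin n) (Fin n) ℝ} {μ : ℂ}
    (hμ : μ ∈ spectrum ℂ (M.map Complex.ofReal)) :
    ∃ x y : Fin n → ℝ, (x ≠ 0 ∨ y ≠ 0) ∧
      M *ᵥ x = μ.re • x - μ.im • y ∧ M *ᵥ y = μ.im • x + μ.re • y := by
  rw [← Matrix.spectrum_toLin', ← Module.End.hasEigenvalue_iff_mem_spectrum] at hμ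
  obtain ⟨v, hv⟩ := hμ.exists_hasEigenvector
  have hMv : M.map Complex.ofReal *ᵥ v = μ • v := by
    simpa only [Matrix.toLin'_apply] using hv.apply_eq_smul
  refine ⟨fun i => (v i).re, fun i => (v i).im, ?_, ?_, ?_⟩
  · by_contra! h
    exact hv.2 (funext fun i => Complex.ext (congrFun h.1 i) (congrFun h.2 i))
  · ext i
    simpa [mulVec, dotProduct] using congrArg Complex.re (congrFun hMv i)
  · ext i
    simpa [mulVec, dotProduct, add_comm] using congrArg Complex.im (congrFun hMv i)

/-- Lyapunov's stability criterion. -/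
theorem isHurwitz_of_lyapunov {n : ℕ} {M P W : Matrix (Fin n) (Fin n) ℝ}
    (hP : P.PosDef) (hW : W.PosDef) (h : P * M + Mᵀ * P = -W) : IsHurwitz M := by
  intro μ hμ
  obtain ⟨x, y, hxy, hx, hy⟩ := exists_re_im_of_mem_spectrum hμ
  have hPsymm : Pᵀ = P := by simpa using hP.isHermitian.eq
  have hcomm (u w : Fin n → ℝ) : u ⬝ᵥ P *ᵥ w = w ⬝ᵥ P *ᵥ u := by
    rw [dotProduct_mulVec, ← mulVec_transpose, hPsymm, dotProduct_comm]
  have hquad (z : Fin n → ℝ) : z ⬝ᵥ W *ᵥ z = -2 * (z ⬝ᵥ P *ᵥ (M *ᵥ z)) := by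
    have hsymm : z ⬝ᵥ (Mᵀ * P) *ᵥ z = z ⬝ᵥ P *ᵥ (M *ᵥ z) := by
      rw [← mulVec_mulVec, dotProduct_mulVec, vecMul_transpose, hcomm]
    have := congrArg (fun N => z ⬝ᵥ N *ᵥ z) h
    simp only [add_mulVec, neg_mulVec, dotProduct_add, dotProduct_neg, hsymm,
      ← mulVec_mulVec _ P M] at this
    linarith
  have hsum {N : Matrix (Fin n) (Fin n) ℝ} (hN : N.PosDef) :
      0 < x ⬝ᵥ N *ᵥ x + y ⬝ᵥ N *ᵥ y := by
    have hnonneg (z : Fin n → ℝ) : 0 ≤ z ⬝ᵥ N *ᵥ z := by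
      simpa using hN.posSemidef.dotProduct_mulVec_nonneg z
    have hpos {z : Fin n → ℝ} (hz : z ≠ 0) : 0 < z ⬝ᵥ N *ᵥ z := by
      simpa using hN.dotProduct_mulVec_pos hz
    rcases hxy with hx0 | hy0
    · exact add_pos_of_pos_of_nonneg (hpos hx0) (hnonneg y)
    · exact add_pos_of_nonneg_of_pos (hnonneg x) (hpos hy0)
  have hWpos := hsum hW
  have hPpos := hsum hP
  rw [hquad, hquad, hx, hy] at hWpos
  simp only [mulVec_sub, mulVec_add, mulVec_smul, dotProduct_sub, dotProduct_add,
    dotProduct_smul, smul_eq_mul, hcomm y x] at hWpos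
  by_contra! hre
  nlinarith [mul_nonneg hre hPpos.le]

theorem closed_loop_Hurwitz_of_posdef_GARE_solution
    {n p q m : ℕ}
    (A : Matrix (Fin n) (Fin n) ℝ) (B₁ : Matrix (Fin n) (Fin p) ℝ)
    (B₂ : Matrix (Fin n) (Fin q) ℝ) (C : Matrix (Fin m) (Fin n) ℝ)
    (R : Matrix (Fin p) (Fin p) ℝ) (hR : R.PosDef)
    (γ : ℝ) (hγ : 0 < γ)
    (Q : Matrix (Fin n) (Fin n) ℝ) (hQ : Q = Cᵀ * C) (hQpd : Q.PosDef)
    (S : Matrix (Fin n) (Fin n) ℝ)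
    (hS : S = B₁ * R⁻¹ * B₁ᵀ - (γ ^ 2)⁻¹ • (B₂ * B₂ᵀ))
    (hSpsd : S.PosSemidef)
    (P : Matrix (Fin n) (Fin n) ℝ) (hP : P.IsSymm) (hPpd : P.PosDef)
    (hGARE : P * A + Aᵀ * P - P * S * P + Q = 0) :
    IsHurwitz (A - S * P) := by
  have hSsymm : Sᵀ = S := by simpa using hSpsd.isHermitian.eq
  have hPSP : (P * S * P).PosSemidef := by
    simpa [hP.eq] using hSpsd.conjTranspose_mul_mul_same P
  refine isHurwitz_of_lyapunov hPpd (hQpd.add_posSemidef hPSP) ?_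
  rw [transpose_sub, transpose_mul, hSsymm, hP.eq, mul_sub, sub_mul, ← mul_assoc P S P]
  rw [← sub_eq_zero, ← hGARE]
  abel
end

section
/- Hamiltonian eigenvalues versus transfer-matrix singular values (the paper's Proposition 6): let K ∈ ℝᵖˣⁿ be such that A − B₁K is Hurwitz, let γ > 0, and let ω ∈ ℝ. Then iω is an eigenvalue of the 2n×2n Hamiltonian matrix H(γ,K) = [[A − B₁K, γ⁻¹B₂B₂ᵀ], [−γ⁻¹(CᵀC + KᵀRK), −(A − B₁K)ᵀ]] if and only if γ is a singular value of the complex m×q matrix T_zw(K)(iω), i.e., if and only if γ² is an eigenvalue of T_zw(K)(iω)ᴴ T_zw(K)(iω). -/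
open Matrix

/-- The closed-loop transfer matrix `T_zw(K)(s) = (C - D K)(s I - A + B₁ K)⁻¹ B₂`. -/
noncomputable def Tzw {n p q m : ℕ}
    (A : Matrix (Fin n) (Fin n) ℝ) (B₁ : Matrix (Fin n) (Fin p) ℝ)
    (B₂ : Matrix (Fin n) (Fin q) ℝ) (C : Matrix (Fin m) (Fin n) ℝ)
    (D : Matrix (Fin m) (Fin p) ℝ) (K : Matrix (Fin p) (Fin n) ℝ)
    (s : ℂ) : Matrix (Fin m) (Fin q) ℂ :=
  (C - D * K).map Complex.ofReal *
    (s • (1 : Matrix (Fin n) (Fin n) ℂ) - (A - B₁ * K).map Complex.ofReal)⁻¹ *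
    B₂.map Complex.ofReal

/-- Schur complement reduction: a shifted Hamiltonian block matrix is invertible exactly when
`c ^ 2` is not an eigenvalue of `(F * X⁻¹ * G)ᴴ * (F * X⁻¹ * G)`. -/
theorem isUnit_fromBlocks_hamiltonian_iff {k l r : Type*} [Fintype k] [DecidableEq k]
    [Fintype l] [Fintype r] [DecidableEq r]
    (X : Matrix k k ℂ) (hX : IsUnit X) (F : Matrix l k ℂ) (G : Matrix k r ℂ)
    (c : ℂ) (hc : c ≠ 0) :
    IsUnit (fromBlocks X (-(c⁻¹ • (G * Gᴴ))) (c⁻¹ • (Fᴴ * F)) (-Xᴴ)) ↔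
      IsUnit (algebraMap ℂ (Matrix r r ℂ) (c ^ 2) - (F * X⁻¹ * G)ᴴ * (F * X⁻¹ * G)) := by
  have := hX.invertible
  have hdet : IsUnit X.det := (isUnit_iff_isUnit_det X).1 hX
  have hXH : Xᴴ * X⁻¹ᴴ = 1 := by
    rw [← conjTranspose_mul, nonsing_inv_mul _ hdet, conjTranspose_one]
  have hfactor : -Xᴴ - c⁻¹ • (Fᴴ * F) * X⁻¹ * -(c⁻¹ • (G * Gᴴ)) =
      -Xᴴ * (1 - (X⁻¹ᴴ * Fᴴ * F * X⁻¹ * G) * ((c ^ 2)⁻¹ • Gᴴ)) := by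
    have h : Xᴴ * (X⁻¹ᴴ * Fᴴ * F * X⁻¹ * G * ((c ^ 2)⁻¹ • Gᴴ)) =
        (c ^ 2)⁻¹ • (Fᴴ * F * X⁻¹ * G * Gᴴ) := by
      simp only [Matrix.mul_smul, ← Matrix.mul_assoc, hXH, Matrix.one_mul]
    rw [Matrix.mul_sub, Matrix.neg_mul, Matrix.neg_mul, h]
    simp only [Matrix.mul_neg, Matrix.mul_smul, Matrix.smul_mul, smul_smul, Matrix.mul_one,
      Matrix.mul_assoc, pow_two, mul_inv]
  have hgram : algebraMap ℂ (Matrix r r ℂ) (c ^ 2) - (F * X⁻¹ * G)ᴴ * (F * X⁻¹ * G) =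
      (c ^ 2) • (1 - ((c ^ 2)⁻¹ • Gᴴ) * (X⁻¹ᴴ * Fᴴ * F * X⁻¹ * G)) := by
    simp only [Algebra.algebraMap_eq_smul_one, smul_sub, Matrix.smul_mul, smul_smul,
      mul_inv_cancel₀ (pow_ne_zero 2 hc), one_smul, conjTranspose_mul, Matrix.mul_assoc]
  have hXunit : IsUnit (-Xᴴ).det := by
    rw [← isUnit_iff_isUnit_det]
    exact ((isUnit_iff_isUnit_det _).2 (by simpa [det_conjTranspose] using hdet)).neg
  rw [isUnit_fromBlocks_iff_of_invertible₁₁, invOf_eq_nonsing_inv, hfactor, hgram,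
    isUnit_iff_isUnit_det, isUnit_iff_isUnit_det, det_mul, det_smul, det_one_sub_mul_comm,
    IsUnit.mul_iff, IsUnit.mul_iff]
  have hcunit : IsUnit ((c ^ 2) ^ Fintype.card r) :=
    (pow_ne_zero _ (pow_ne_zero 2 hc)).isUnit
  simp only [hXunit, hcunit, true_and]

theorem hamiltonian_eigenvalues_vs_singular_values
    {n p q m : ℕ}
    (A : Matrix (Fin n) (Fin n) ℝ) (B₁ : Matrix (Fin n) (Fin p) ℝ)
    (B₂ : Matrix (Fin n) (Fin q) ℝ) (C : Matrix (Fin m) (Fin n) ℝ)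
    (R : Matrix (Fin p) (Fin p) ℝ) (hR : R.PosDef)
    (D : Matrix (Fin m) (Fin p) ℝ) (hDC : Dᵀ * C = 0) (hDD : Dᵀ * D = R)
    (K : Matrix (Fin p) (Fin n) ℝ) (hK : IsHurwitz (A - B₁ * K))
    (γ : ℝ) (hγ : 0 < γ) (ω : ℝ)
    (H : Matrix ((Fin n) ⊕ (Fin n)) ((Fin n) ⊕ (Fin n)) ℝ)
    (hH : H = Matrix.fromBlocks
      (A - B₁ * K) (γ⁻¹ • (B₂ * B₂ᵀ))
      (-(γ⁻¹ • (Cᵀ * C + Kᵀ * R * K))) (-(A - B₁ * K)ᵀ)) :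
    (Complex.I * (ω : ℂ)) ∈ spectrum ℂ (H.map Complex.ofReal) ↔
      ((γ : ℂ) ^ 2) ∈ spectrum ℂ
        ((Tzw A B₁ B₂ C D K (Complex.I * (ω : ℂ)))ᴴ *
          Tzw A B₁ B₂ C D K (Complex.I * (ω : ℂ))) := by
  have conj_map : ∀ {a b : ℕ} (N : Matrix (Fin a) (Fin b) ℝ),
      (N.map Complex.ofReal)ᴴ = Nᵀ.map Complex.ofReal := by
    intro a b N
    ext i j
    simp
  have map_mul' : ∀ {a b d : ℕ} (N : Matrix (Fin a) (Fin b) ℝ) (P : Matrix (Fin b) (Fin d) ℝ),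
      (N * P).map Complex.ofReal = N.map Complex.ofReal * P.map Complex.ofReal :=
    fun N P => Matrix.map_mul (f := Complex.ofRealHom)
  set M := A - B₁ * K
  set s : ℂ := Complex.I * (ω : ℂ) with hs
  have hX : IsUnit (s • (1 : Matrix (Fin n) (Fin n) ℂ) - M.map Complex.ofReal) := by
    by_contra h
    have hre := hK s (by rwa [spectrum.mem_iff, Algebra.algebraMap_eq_smul_one])
    simp [hs] at hre
  have hγ' : (γ : ℂ) ≠ 0 := by exact_mod_cast hγ.ne'
  have hstar : (starRingEnd ℂ) s = -s := by simp [hs]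
  have hCD : Cᵀ * D = 0 := by
    simpa [transpose_mul] using congrArg transpose hDC
  have hgram : Cᵀ * C + Kᵀ * R * K = (C - D * K)ᵀ * (C - D * K) := by
    rw [transpose_sub, transpose_mul, Matrix.sub_mul, Matrix.mul_sub, Matrix.mul_sub,
      ← Matrix.mul_assoc Cᵀ, hCD, Matrix.mul_assoc Kᵀ Dᵀ C, hDC, ← hDD]
    simp [Matrix.mul_assoc]
  have hblocks : algebraMap ℂ (Matrix (Fin n ⊕ Fin n) (Fin n ⊕ Fin n) ℂ) s -
      H.map Complex.ofReal =
      fromBlocks (s • (1 : Matrix (Fin n) (Fin n) ℂ) - M.map Complex.ofReal)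
        (-((γ : ℂ)⁻¹ • (B₂.map Complex.ofReal * (B₂.map Complex.ofReal)ᴴ)))
        ((γ : ℂ)⁻¹ • (((C - D * K).map Complex.ofReal)ᴴ * (C - D * K).map Complex.ofReal))
        (-(s • (1 : Matrix (Fin n) (Fin n) ℂ) - M.map Complex.ofReal)ᴴ) := by
    rw [hH, hgram, conj_map, conj_map, ← map_mul', ← map_mul',
      Algebra.algebraMap_eq_smul_one, ← fromBlocks_one, fromBlocks_smul, fromBlocks_map,
      sub_eq_add_neg, fromBlocks_neg, fromBlocks_add, conjTranspose_sub, conj_map,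
      conjTranspose_smul]
    congr 1
    · ext i j
      simp
    · ext i j
      simp
    · ext i j
      simp [hstar]
      ring
  rw [spectrum.mem_iff, spectrum.mem_iff, hblocks, not_iff_not]
  exact isUnit_fromBlocks_hamiltonian_iff _ hX _ _ _ hγ'
end

section
/- L₂-gain (disturbance attenuation) property of the GARE controller: let γ > 0 and let P be a symmetric positive semidefinite n×n real matrix solving the GARE. Let w : [0, ∞) → ℝ^q be continuous with ∫₀^∞ ‖w(t)‖² dt < ∞, and let x : [0, ∞) → ℝⁿ be a differentiable solution of ẋ(t) = (A − B₁R⁻¹B₁ᵀP)x(t) + B₂w(t) with x(0) = x₀ and x(t) → 0 as t → ∞. Then, writing u(t) := −R⁻¹B₁ᵀP x(t), ∫₀^∞ (x(t)ᵀQx(t) + u(t)ᵀRu(t)) dt ≤ γ² ∫₀^∞ ‖w(t)‖² dt + x₀ᵀPx₀. -/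
open Matrix MeasureTheory Filter

theorem HasDerivAt.dotProduct {ι : Type*} [Fintype ι] {f g : ℝ → ι → ℝ} {f' g' : ι → ℝ} {t : ℝ}
    (hf : HasDerivAt f f' t) (hg : HasDerivAt g g' t) :
    HasDerivAt (fun s => f s ⬝ᵥ g s) (f' ⬝ᵥ g t + f t ⬝ᵥ g') t := by
  have h := HasDerivAt.fun_sum (u := Finset.univ) fun i _ =>
    (hasDerivAt_pi.1 hf i).mul (hasDerivAt_pi.1 hg i)
  simpa only [_root_.dotProduct, Finset.sum_add_distrib] using! h

theorem HasDerivAt.matrix_mulVec {ι κ : Type*} [Fintype ι] [Fintype κ] (M : Matrix κ ι ℝ)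
    {f : ℝ → ι → ℝ} {f' : ι → ℝ} {t : ℝ} (hf : HasDerivAt f f' t) :
    HasDerivAt (fun s => M *ᵥ f s) (M *ᵥ f') t :=
  (LinearMap.toContinuousLinearMap M.mulVecLin).hasFDerivAt.comp_hasDerivAt t hf

theorem Matrix.mulVec_dotProduct_eq {ι κ : Type*} [Fintype ι] [Fintype κ] (M : Matrix κ ι ℝ)
    (a : κ → ℝ) (b : ι → ℝ) : (Mᵀ *ᵥ a) ⬝ᵥ b = a ⬝ᵥ (M *ᵥ b) := by
  rw [dotProduct_mulVec, mulVec_transpose]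

/-- Young's inequality for the dot product. -/
theorem two_mul_dotProduct_le {ι : Type*} [Fintype ι] {γ : ℝ} (hγ : 0 < γ) (a b : ι → ℝ) :
    2 * (a ⬝ᵥ b) ≤ γ ^ 2 * (b ⬝ᵥ b) + (γ ^ 2)⁻¹ * (a ⬝ᵥ a) := by
  simp only [dotProduct, Finset.mul_sum, ← Finset.sum_add_distrib]
  refine Finset.sum_le_sum fun i _ => ?_
  have h := sq_nonneg (γ * b i - γ⁻¹ * a i)
  have e : (γ * b i - γ⁻¹ * a i) ^ 2
      = γ ^ 2 * (b i * b i) + (γ ^ 2)⁻¹ * (a i * a i) - 2 * (a i * b i) := by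
    field_simp
    ring
  linarith

/-- The dissipation inequality for the storage function `ξ ↦ ξᵀPξ`, at a state `ξ` and a
disturbance `η`, when `P` solves the generalized algebraic Riccati equation. -/
theorem dissipation_of_GARE {n p q : ℕ}
    {A : Matrix (Fin n) (Fin n) ℝ} {B₁ : Matrix (Fin n) (Fin p) ℝ}
    {B₂ : Matrix (Fin n) (Fin q) ℝ} {R : Matrix (Fin p) (Fin p) ℝ} (hR : IsUnit R.det)
    {γ : ℝ} (hγ : 0 < γ) {Q P : Matrix (Fin n) (Fin n) ℝ} (hP : Pᵀ = P)
    (hGARE : P * A + Aᵀ * P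
        - P * (B₁ * R⁻¹ * B₁ᵀ - (γ ^ 2)⁻¹ • (B₂ * B₂ᵀ)) * P + Q = 0)
    (ξ ξ' : Fin n → ℝ) (η : Fin q → ℝ) (υ : Fin p → ℝ)
    (hξ' : ξ' = (A - B₁ * (R⁻¹ * B₁ᵀ * P)) *ᵥ ξ + B₂ *ᵥ η)
    (hυ : υ = -((R⁻¹ * B₁ᵀ * P) *ᵥ ξ)) :
    ξ' ⬝ᵥ (P *ᵥ ξ) + ξ ⬝ᵥ (P *ᵥ ξ')
      ≤ γ ^ 2 * (η ⬝ᵥ η) - (ξ ⬝ᵥ (Q *ᵥ ξ) + υ ⬝ᵥ (R *ᵥ υ)) := by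
  have hPd (a : Fin n → ℝ) : ξ ⬝ᵥ (P *ᵥ a) = (P *ᵥ ξ) ⬝ᵥ a := by
    rw [← mulVec_dotProduct_eq, hP]
  have hG := congrArg (fun M => ξ ⬝ᵥ (M *ᵥ ξ)) hGARE
  simp only [add_mulVec, sub_mulVec, Matrix.mul_sub, Matrix.sub_mul, Matrix.mul_smul,
    Matrix.smul_mul, smul_mulVec, ← mulVec_mulVec, dotProduct_add, dotProduct_sub,
    dotProduct_smul, hPd, zero_mulVec, dotProduct_zero, smul_eq_mul] at hG
  have hAT : ξ ⬝ᵥ (Aᵀ *ᵥ (P *ᵥ ξ)) = (P *ᵥ ξ) ⬝ᵥ (A *ᵥ ξ) := by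
    rw [dotProduct_comm, mulVec_dotProduct_eq]
  have hRR : R *ᵥ (R⁻¹ *ᵥ (B₁ᵀ *ᵥ (P *ᵥ ξ))) = B₁ᵀ *ᵥ (P *ᵥ ξ) := by
    rw [mulVec_mulVec, Matrix.mul_nonsing_inv _ hR, one_mulVec]
  have hcost : υ ⬝ᵥ (R *ᵥ υ)
      = (P *ᵥ ξ) ⬝ᵥ (B₁ *ᵥ (R⁻¹ *ᵥ (B₁ᵀ *ᵥ (P *ᵥ ξ)))) := by
    rw [hυ, mulVec_neg, neg_dotProduct_neg, ← mulVec_mulVec, ← mulVec_mulVec, hRR,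
      dotProduct_comm, mulVec_dotProduct_eq]
  have hder : (P *ᵥ ξ) ⬝ᵥ ξ' = (P *ᵥ ξ) ⬝ᵥ (A *ᵥ ξ)
      - (P *ᵥ ξ) ⬝ᵥ (B₁ *ᵥ (R⁻¹ *ᵥ (B₁ᵀ *ᵥ (P *ᵥ ξ)))) + (B₂ᵀ *ᵥ (P *ᵥ ξ)) ⬝ᵥ η := by
    rw [hξ', mulVec_dotProduct_eq]
    simp only [sub_mulVec, ← mulVec_mulVec, dotProduct_add, dotProduct_sub]
  have hY := two_mul_dotProduct_le hγ (B₂ᵀ *ᵥ (P *ᵥ ξ)) η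
  rw [mulVec_dotProduct_eq B₂ _ (B₂ᵀ *ᵥ (P *ᵥ ξ))] at hY
  rw [hPd, dotProduct_comm ξ', hder, hcost]
  linarith

/-- A dissipation inequality `V' ≤ h - f` on `[0, ∞)` with nonnegative storage `V` bounds the total
dissipation `∫ f` by the total supply `∫ h` plus the initial storage. -/
theorem lintegral_le_of_dissipation {V V' f h : ℝ → ℝ}
    (hV : ∀ t, 0 ≤ t → HasDerivAt V (V' t) t) (hV0 : ∀ t, 0 ≤ V t)
    (hf : ContinuousOn f (Set.Ici 0)) (hf0 : ∀ t, 0 ≤ f t)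
    (hh : IntegrableOn h (Set.Ioi 0)) (hh0 : ∀ t, 0 ≤ h t)
    (hle : ∀ t, 0 ≤ t → V' t ≤ h t - f t) :
    ∫⁻ t in Set.Ioi (0 : ℝ), ENNReal.ofReal (f t)
      ≤ ENNReal.ofReal ((∫ t in Set.Ioi (0 : ℝ), h t) + V 0) := by
  have hcover : AECover (volume.restrict (Set.Ioi (0 : ℝ))) atTop fun T : ℝ => Set.Iic T :=
    aecover_Iic tendsto_id
  have hmeas : AEMeasurable (fun t => ENNReal.ofReal (f t)) (volume.restrict (Set.Ioi (0 : ℝ))) :=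
    ((hf.mono Set.Ioi_subset_Ici_self).aemeasurable measurableSet_Ioi).ennreal_ofReal
  refine le_of_tendsto (hcover.lintegral_tendsto_of_countably_generated hmeas) ?_
  filter_upwards [eventually_ge_atTop 0] with T hT
  have hfT : IntegrableOn f (Set.Icc 0 T) :=
    (hf.mono Set.Icc_subset_Ici_self).integrableOn_Icc
  have hhT : IntegrableOn h (Set.Icc 0 T) :=
    (integrableOn_Icc_iff_integrableOn_Ioc (by simp)).2 (hh.mono_set Set.Ioc_subset_Ioi_self)
  have key := intervalIntegral.sub_le_integral_of_hasDeriv_right_of_le hT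
    (fun t ht => (hV t ht.1).continuousAt.continuousWithinAt)
    (fun t ht => (hV t ht.1.le).hasDerivWithinAt) (hhT.sub hfT) (fun t ht => hle t ht.1.le)
  rw [intervalIntegral.integral_of_le hT] at key
  simp only [Pi.sub_apply] at key
  rw [integral_sub (hhT.mono_set Set.Ioc_subset_Icc_self) (hfT.mono_set Set.Ioc_subset_Icc_self)]
    at key
  have hmono : ∫ t in Set.Ioc 0 T, h t ≤ ∫ t in Set.Ioi (0 : ℝ), h t :=
    setIntegral_mono_set hh (ae_of_all _ hh0) Set.Ioc_subset_Ioi_self.eventuallyLE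
  rw [Measure.restrict_restrict measurableSet_Iic, Set.Iic_inter_Ioi,
    ← ofReal_integral_eq_lintegral_ofReal (hfT.mono_set Set.Ioc_subset_Icc_self)
      (ae_of_all _ hf0)]
  refine ENNReal.ofReal_le_ofReal ?_
  linarith [hV0 T]

theorem l2_gain_of_GARE_controller
    {n p q m : ℕ}
    (A : Matrix (Fin n) (Fin n) ℝ) (B₁ : Matrix (Fin n) (Fin p) ℝ)
    (B₂ : Matrix (Fin n) (Fin q) ℝ) (C : Matrix (Fin m) (Fin n) ℝ)
    (R : Matrix (Fin p) (Fin p) ℝ) (hR : R.PosDef)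
    (γ : ℝ) (hγ : 0 < γ)
    (Q : Matrix (Fin n) (Fin n) ℝ) (hQ : Q = Cᵀ * C)
    (P : Matrix (Fin n) (Fin n) ℝ) (hP : P.PosSemidef)
    (hGARE : P * A + Aᵀ * P
        - P * (B₁ * R⁻¹ * B₁ᵀ - (γ ^ 2)⁻¹ • (B₂ * B₂ᵀ)) * P + Q = 0)
    (w : ℝ → Fin q → ℝ) (hw : Continuous w)
    (hwInt : IntegrableOn (fun t => w t ⬝ᵥ w t) (Set.Ioi (0 : ℝ)))
    (x : ℝ → Fin n → ℝ) (x₀ : Fin n → ℝ) (hx0 : x 0 = x₀)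
    (hode : ∀ t : ℝ, 0 ≤ t →
      HasDerivAt x ((A - B₁ * (R⁻¹ * B₁ᵀ * P)) *ᵥ x t + B₂ *ᵥ w t) t)
    (hxlim : Tendsto x atTop (nhds 0))
    (u : ℝ → Fin p → ℝ) (hu : ∀ t : ℝ, u t = -((R⁻¹ * B₁ᵀ * P) *ᵥ x t)) :
    ∫⁻ t in Set.Ioi (0 : ℝ),
        ENNReal.ofReal (x t ⬝ᵥ (Q *ᵥ x t) + u t ⬝ᵥ (R *ᵥ u t))
      ≤ ENNReal.ofReal
          (γ ^ 2 * (∫ t in Set.Ioi (0 : ℝ), w t ⬝ᵥ w t) + x₀ ⬝ᵥ (P *ᵥ x₀)) := by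
  have hRdet : IsUnit R.det := hR.det_pos.ne'.isUnit
  have hxc : ContinuousOn x (Set.Ici 0) := fun t ht =>
    (hode t ht).continuousAt.continuousWithinAt
  have hQ0 (a : Fin n → ℝ) : 0 ≤ a ⬝ᵥ (Q *ᵥ a) := by
    have h := (posSemidef_conjTranspose_mul_self C).dotProduct_mulVec_nonneg a
    rwa [conjTranspose_eq_transpose_of_trivial, ← hQ, star_trivial] at h
  have hcost : ContinuousOn (fun t => x t ⬝ᵥ (Q *ᵥ x t) + u t ⬝ᵥ (R *ᵥ u t)) (Set.Ici 0) := by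
    have hc : Continuous fun ξ : Fin n → ℝ => ξ ⬝ᵥ (Q *ᵥ ξ)
        + (-((R⁻¹ * B₁ᵀ * P) *ᵥ ξ)) ⬝ᵥ (R *ᵥ (-((R⁻¹ * B₁ᵀ * P) *ᵥ ξ))) := by
      fun_prop
    simpa only [hu, Function.comp_def] using hc.comp_continuousOn hxc
  have main := lintegral_le_of_dissipation (V := fun t => x t ⬝ᵥ (P *ᵥ x t))
    (h := fun t => γ ^ 2 * (w t ⬝ᵥ w t))
    (fun t ht => (hode t ht).dotProduct ((hode t ht).matrix_mulVec P))
    (fun t => by simpa using hP.dotProduct_mulVec_nonneg (x t)) hcost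
    (fun t => add_nonneg (hQ0 _) (by simpa using hR.posSemidef.dotProduct_mulVec_nonneg (u t)))
    (hwInt.const_mul _)
    (fun t => mul_nonneg (sq_nonneg _) (by simpa using dotProduct_star_self_nonneg (w t)))
    (fun t _ => dissipation_of_GARE hRdet hγ (by simpa using hP.isHermitian.eq) hGARE _ _ _ _
      rfl (hu t))
  rwa [integral_const_mul, hx0] at main
end
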